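/- For any countable set C of strongly upper explorable environments there exists a policy p which is worst-case upper self-optimizing for C, i.e., limsup_m (1/m) r_{1..m}^{pν} ≥ W̄*_ν with probability 1 for every ν ∈ C. -/

import Mathlib

open MeasureTheory Filter Finset Asymptotics
open scoped ENNReal Classical

noncomputable section

namespace RL

/-- A perception `x = (r, o)`: a reward `r ∈ R = {0, …, r_max}` together with an
observation `o ∈ O`. -/
abbrev Percept (O : Type) (rmax : ℕ) := Fin (rmax + 1) × O

/-- A cycle `z = (y, r, o)`: an action together with the resulting perception. -/
abbrev Cycle (Y O : Type) (rmax : ℕ) := Y × Percept O rmax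

/-- A deterministic policy maps a history `z_{<k}` to the next action `y_k`. -/
abbrev Policy (Y O : Type) (rmax : ℕ) := List (Cycle Y O rmax) → Y

/-- An infinite interaction sequence. -/
abbrev Traj (Y O : Type) (rmax : ℕ) := ℕ → Cycle Y O rmax

instance (Y O : Type) (rmax : ℕ) : MeasurableSpace (Cycle Y O rmax) := ⊤

/-- The reward of a cycle `z = (y, (r, o))`, as a real number. -/
def rew {Y O : Type} {rmax : ℕ} (z : Cycle Y O rmax) : ℝ := ((z.2.1 : ℕ) : ℝ)

/-- The cylinder set of all infinite sequences extending the finite sequence `l`. -/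
def cylSet {A : Type} (l : List A) : Set (ℕ → A) := {ω | ∀ i : Fin l.length, ω i.1 = l.get i}

/-- An environment: conditional probabilities `ν(x_k | z_{<k} y_k)` of the next perception
given the history, together with, for each (deterministic) policy `p`, the induced
probability measure on interaction sequences, which on cylinder sets is given by the
product of the conditional probabilities (actions being forced by the policy). -/
structure Environment (Y O : Type) [Fintype Y] [Fintype O] (rmax : ℕ) where
  cond : List (Cycle Y O rmax) → Y → Percept O rmax → ℝ
  cond_nonneg : ∀ h y x, 0 ≤ cond h y x
  cond_sum_one : ∀ h y, ∑ x : Percept O rmax, cond h y x = 1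
  P : Policy Y O rmax → Measure (Traj Y O rmax)
  P_prob : ∀ p, IsProbabilityMeasure (P p)
  P_cyl : ∀ (p : Policy Y O rmax) (h : List (Cycle Y O rmax)) (z : Cycle Y O rmax),
    P p (cylSet (h ++ [z]))
      = P p (cylSet h) * ENNReal.ofReal (if z.1 = p h then cond h z.1 z.2 else 0)

variable {Y O : Type} [Fintype Y] [Fintype O] {rmax : ℕ}

/-- The average reward `(1/m) r_{1..m}` of the first `m` steps of a trajectory. -/
def avg {Y O : Type} {rmax : ℕ} (ω : Traj Y O rmax) (m : ℕ) : ℝ :=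
  (∑ i ∈ Finset.range m, rew (ω i)) / m

/-- `V(ν,p) = V` : the average limiting value exists a.s. and equals the constant `V`. -/
def ValueIs (ν : Environment Y O rmax) (p : Policy Y O rmax) (V : ℝ) : Prop :=
  ν.P p {ω | Tendsto (avg ω) atTop (nhds V)} = 1

/-- `V̄(ν,p) = V` : the upper limiting average value is a.s. the constant `V`. -/
def UpperValueIs (ν : Environment Y O rmax) (p : Policy Y O rmax) (V : ℝ) : Prop :=
  ν.P p {ω | limsup (avg ω) atTop = V} = 1

/-- `V` is the optimal value `V*_ν` of `ν`: some policy `p_ν` achieves average value `V`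
a.s., and every policy has upper average value `≤ V` a.s. -/
def IsOptimalValue (ν : Environment Y O rmax) (V : ℝ) : Prop :=
  ∃ p, ValueIs ν p V ∧ ∀ q : Policy Y O rmax, ν.P q {ω | limsup (avg ω) atTop ≤ V} = 1

/-- An environment is explorable if it has an optimal value `V*_ν`. -/
def Explorable (ν : Environment Y O rmax) : Prop := ∃ V, IsOptimalValue ν V

/-- `V` is the upper optimal value `V̄*_ν` of `ν`. -/
def IsUpperOptimalValue (ν : Environment Y O rmax) (V : ℝ) : Prop :=
  ∃ p, UpperValueIs ν p V ∧ ∀ q : Policy Y O rmax, ν.P q {ω | limsup (avg ω) atTop ≤ V} = 1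

/-- An environment is upper explorable if it has an upper optimal value `V̄*_ν`. -/
def UpperExplorable (ν : Environment Y O rmax) : Prop := ∃ V, IsUpperOptimalValue ν V

/-- `ν(x_{<k} | y_{<k})` : the probability of the perceptions of the history `h`,
given its actions. -/
def histProbX (ν : Environment Y O rmax) (h : List (Cycle Y O rmax)) : ℝ :=
  ∏ i : Fin h.length, ν.cond (h.take i.1) (h.get i).1 (h.get i).2

/-- Replace the first `k-1` actions of the policy `p` by the actions `y_{<k}` of the
history `h`. -/
def replacePolicy (h : List (Cycle Y O rmax)) (p : Policy Y O rmax) : Policy Y O rmax :=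
  fun l => if hl : l.length < h.length then (h.get ⟨l.length, hl⟩).1 else p l

/-- The measure induced by `(p, ν)` conditional on the history `h = z_{<k}`:
`ν`-probabilities conditional on `x_{<k}`, with the first `k-1` actions of `p`
replaced by `y_{<k}`. -/
def condMeasure (ν : Environment Y O rmax) (p : Policy Y O rmax)
    (h : List (Cycle Y O rmax)) : Measure (Traj Y O rmax) :=
  ProbabilityTheory.cond (ν.P (replacePolicy h p)) (cylSet h)

/-- `P( · | z_{<k})` under policy `p` in environment `ν`. -/
def condProb (ν : Environment Y O rmax) (p : Policy Y O rmax)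
    (h : List (Cycle Y O rmax)) (A : Set (Traj Y O rmax)) : ℝ≥0∞ :=
  condMeasure ν p h A

/-- `V(ν,p,z_{<k}) = V` : conditional on `z_{<k}`, the average limiting value is a.s. `V`. -/
def CondValueIs (ν : Environment Y O rmax) (p : Policy Y O rmax)
    (h : List (Cycle Y O rmax)) (V : ℝ) : Prop :=
  condProb ν p h {ω | Tendsto (avg ω) atTop (nhds V)} = 1

/-- `V̄(ν,p,z_{<k}) = V` : conditional on `z_{<k}`, the upper limiting average value
is a.s. `V`. -/
def CondUpperValueIs (ν : Environment Y O rmax) (p : Policy Y O rmax)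
    (h : List (Cycle Y O rmax)) (V : ℝ) : Prop :=
  condProb ν p h {ω | limsup (avg ω) atTop = V} = 1

/-- `V` is the conditional optimal value `V*_ν(z_{<k})`. -/
def IsCondOptimalValue (ν : Environment Y O rmax) (h : List (Cycle Y O rmax)) (V : ℝ) : Prop :=
  ∃ p, CondValueIs ν p h V ∧
    ∀ q : Policy Y O rmax, condProb ν q h {ω | limsup (avg ω) atTop ≤ V} = 1

/-- `V` is the conditional upper optimal value `V̄*_ν(z_{<k})`. -/
def IsCondUpperOptimalValue (ν : Environment Y O rmax) (h : List (Cycle Y O rmax)) (V : ℝ) :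
    Prop :=
  ∃ p, CondUpperValueIs ν p h V ∧
    ∀ q : Policy Y O rmax, condProb ν q h {ω | limsup (avg ω) atTop ≤ V} = 1

/-- Strongly explorable: after any history of positive probability there is a conditionally
optimal value. -/
def StronglyExplorable (ν : Environment Y O rmax) : Prop :=
  ∀ h, 0 < histProbX ν h → ∃ V, IsCondOptimalValue ν h V

/-- Strongly upper explorable. -/
def StronglyUpperExplorable (ν : Environment Y O rmax) : Prop :=
  ∀ h, 0 < histProbX ν h → ∃ V, IsCondUpperOptimalValue ν h V

/-- The worst-case optimal value `W*_ν = inf_{z_{<k}} V*_ν(z_{<k})`. -/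
def Wstar (ν : Environment Y O rmax) : ℝ :=
  sInf {V | ∃ h, 0 < histProbX ν h ∧ IsCondOptimalValue ν h V}

/-- The worst-case upper optimal value `W̄*_ν = inf_{z_{<k}} V̄*_ν(z_{<k})`. -/
def WstarUpper (ν : Environment Y O rmax) : ℝ :=
  sInf {V | ∃ h, 0 < histProbX ν h ∧ IsCondUpperOptimalValue ν h V}

/-- Recoverable: after any history of positive probability, some policy attains the
upper optimal value `V̄*_ν` with conditional probability 1. -/
def Recoverable (ν : Environment Y O rmax) : Prop :=
  ∃ V, IsUpperOptimalValue ν V ∧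
    ∀ h, 0 < histProbX ν h →
      ∃ p, condProb ν p h {ω | limsup (avg ω) atTop = V} = 1

/-- The quantitative part of value-stability, with target value `W`:
rewards `r_i ∈ [0, r_max]` with `(1/n) r_{1..n} → W`, `d(k,ε) = o(k)`,
`Σ_n φ(n,ε) < ∞`, and from any history `z_{<k}` some policy `p` recovers:
`P( r_{k..k+n} − r^{pν}_{k..k+n} > d(k,ε) + nε | z_{<k} ) ≤ φ(n,ε)`. -/
def ValueStableCore (ν : Environment Y O rmax) (W : ℝ) (r : ℕ → ℝ)
    (d : ℕ → ℝ → ℝ) (φ : ℕ → ℝ → ℝ) : Prop :=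
  (∀ i, r i ∈ Set.Icc (0 : ℝ) (rmax : ℝ)) ∧
  Tendsto (fun n => (∑ i ∈ Finset.range n, r i) / n) atTop (nhds W) ∧
  (∀ ε : ℝ, 0 < ε → (fun k : ℕ => d k ε) =o[atTop] fun k : ℕ => (k : ℝ)) ∧
  (∀ ε : ℝ, 0 < ε → Summable fun n => φ n ε) ∧
  ∀ h : List (Cycle Y O rmax), ∃ p : Policy Y O rmax, ∀ ε : ℝ, 0 < ε → ∀ n : ℕ,
    condProb ν p h
      {ω | d h.length ε + n * ε <
        (∑ i ∈ Finset.Icc h.length (h.length + n), r i)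
          - ∑ i ∈ Finset.Icc h.length (h.length + n), rew (ω i)}
      ≤ ENNReal.ofReal (φ n ε)

/-- Value-stability with explicit witnesses `V = V*_ν`, `r`, `d`, `φ`. -/
def ValueStableWith (ν : Environment Y O rmax) (V : ℝ) (r : ℕ → ℝ)
    (d : ℕ → ℝ → ℝ) (φ : ℕ → ℝ → ℝ) : Prop :=
  IsOptimalValue ν V ∧ ValueStableCore ν V r d φ

/-- A value-stable environment. -/
def ValueStable (ν : Environment Y O rmax) : Prop :=
  ∃ V r d φ, ValueStableWith ν V r d φ

/-- A worst-case value-stable environment: strongly explorable, and the value-stability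
condition holds with target `W*_ν`. -/
def WorstCaseValueStable (ν : Environment Y O rmax) : Prop :=
  StronglyExplorable ν ∧ ∃ r d φ, ValueStableCore ν (Wstar ν) r d φ

/-- A policy is self-optimizing for a class `C` if it attains the optimal value `V*_ν`
in every `ν ∈ C`. -/
def SelfOptimizing (p : Policy Y O rmax) (C : Set (Environment Y O rmax)) : Prop :=
  ∀ ν ∈ C, ∀ V, IsOptimalValue ν V → ValueIs ν p V

/-- A policy is upper self-optimizing for a class `C` if it attains the upper optimal
value `V̄*_ν` in every `ν ∈ C`. -/
def UpperSelfOptimizing (p : Policy Y O rmax) (C : Set (Environment Y O rmax)) : Prop :=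
  ∀ ν ∈ C, ∀ V, IsUpperOptimalValue ν V → UpperValueIs ν p V

/-- A deterministic environment: all conditional probabilities are `0` or `1`. -/
def Deterministic (ν : Environment Y O rmax) : Prop :=
  ∀ h y x, ν.cond h y x = 0 ∨ ν.cond h y x = 1

/-- In a deterministic environment, the perception following history `h` and action `y`. -/
def pick [Nonempty O] (ν : Environment Y O rmax) (h : List (Cycle Y O rmax)) (y : Y) :
    Percept O rmax :=
  if hx : ∃ x, ν.cond h y x = 1 then hx.choose else Classical.arbitrary _

/-- The (deterministic) history generated by policy `p` in a deterministic environment. -/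
def detHist [Nonempty O] (ν : Environment Y O rmax) (p : Policy Y O rmax) :
    ℕ → List (Cycle Y O rmax)
  | 0 => []
  | n + 1 =>
      detHist ν p n ++ [(p (detHist ν p n), pick ν (detHist ν p n) (p (detHist ν p n)))]

/-- The cycle `z_n` generated by policy `p` in a deterministic environment. -/
def detZ [Nonempty O] (ν : Environment Y O rmax) (p : Policy Y O rmax) (n : ℕ) :
    Cycle Y O rmax :=
  (p (detHist ν p n), pick ν (detHist ν p n) (p (detHist ν p n)))

end RL

namespace RL

section Trajectories

variable {Y O : Type} {rmax : ℕ}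

instance : DiscreteMeasurableSpace (Cycle Y O rmax) := ⟨fun _ => trivial⟩

/-- The first `n` cycles of a trajectory. -/
def initialSegment (n : ℕ) (ω : Traj Y O rmax) : Fin n → Cycle Y O rmax := fun i => ω i

lemma measurable_initialSegment (n : ℕ) :
    Measurable (initialSegment n : Traj Y O rmax → Fin n → Cycle Y O rmax) :=
  measurable_pi_lambda _ fun _ => measurable_pi_apply _

lemma cylSet_ofFn {n : ℕ} (t : Fin n → Cycle Y O rmax) :
    cylSet (List.ofFn t) = initialSegment n ⁻¹' {t} := by
  ext ω
  simp only [cylSet, initialSegment, Set.mem_ofPred_eq, Set.mem_preimage, Set.mem_singleton_iff,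
    funext_iff]
  constructor
  · intro h i
    simpa using h ⟨i, by simp⟩
  · intro h i
    simpa using h ⟨i, by simpa using i.2⟩

lemma measurableSet_cylSet (h : List (Cycle Y O rmax)) : MeasurableSet (cylSet h) := by
  rw [← List.ofFn_get h, cylSet_ofFn]
  exact measurable_initialSegment _ (measurableSet_singleton _)

lemma cylSet_append_subset (h s : List (Cycle Y O rmax)) : cylSet (h ++ s) ⊆ cylSet h := by
  intro ω hω i
  have := hω ⟨i, by simp; omega⟩
  simpa using this

lemma cylSet_inter_eq_empty {h l : List (Cycle Y O rmax)} (hlen : h.length ≤ l.length)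
    (hpre : ¬ h <+: l) : cylSet l ∩ cylSet h = ∅ := by
  refine Set.eq_empty_of_forall_notMem fun ω hω => hpre ?_
  rw [List.prefix_iff_eq_take]
  refine List.ext_getElem (by simpa using hlen) fun i h₁ h₂ => ?_
  have h₃ := hω.1 ⟨i, h₁.trans_le hlen⟩
  have h₄ := hω.2 ⟨i, h₁⟩
  simp only [List.get_eq_getElem] at h₃ h₄
  rw [List.getElem_take, ← h₃, ← h₄]

lemma rew_nonneg (z : Cycle Y O rmax) : 0 ≤ rew z := Nat.cast_nonneg _

lemma rew_le (z : Cycle Y O rmax) : rew z ≤ rmax :=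
  Nat.cast_le.2 (Nat.lt_succ_iff.1 z.2.1.2)

lemma avg_nonneg (ω : Traj Y O rmax) (m : ℕ) : 0 ≤ avg ω m :=
  div_nonneg (Finset.sum_nonneg fun _ _ => rew_nonneg _) (Nat.cast_nonneg _)

lemma avg_le (ω : Traj Y O rmax) (m : ℕ) : avg ω m ≤ rmax := by
  refine div_le_of_le_mul₀ (Nat.cast_nonneg _) (Nat.cast_nonneg _) ?_
  calc ∑ i ∈ Finset.range m, rew (ω i) ≤ ∑ _i ∈ Finset.range m, (rmax : ℝ) :=
        Finset.sum_le_sum fun _ _ => rew_le _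
    _ = rmax * m := by simp [mul_comm]

lemma isBoundedUnder_le_avg (ω : Traj Y O rmax) : IsBoundedUnder (· ≤ ·) atTop (avg ω) :=
  isBoundedUnder_of ⟨rmax, avg_le ω⟩

lemma isBoundedUnder_ge_avg (ω : Traj Y O rmax) : IsBoundedUnder (· ≥ ·) atTop (avg ω) :=
  isBoundedUnder_of ⟨0, avg_nonneg ω⟩

lemma limsup_avg_nonneg (ω : Traj Y O rmax) : 0 ≤ limsup (avg ω) atTop :=
  le_limsup_of_frequently_le (Frequently.of_forall (avg_nonneg ω)) (isBoundedUnder_le_avg ω)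

lemma avg_congr {ω ω' : Traj Y O rmax} {m : ℕ} (h : ∀ i < m, ω i = ω' i) :
    avg ω m = avg ω' m := by
  unfold avg
  rw [Finset.sum_congr rfl fun i hi => by rw [h i (Finset.mem_range.1 hi)]]

/-- The trajectories whose average reward stays below `c` throughout the times in `(a, b]`. -/
def staysBelow (c : ℝ) (a b : ℕ) : Set (Traj Y O rmax) :=
  {ω | ∀ m, a < m → m ≤ b → avg ω m < c}

lemma staysBelow_eq_preimage (c : ℝ) (a b : ℕ) :
    (staysBelow c a b : Set (Traj Y O rmax))
      = initialSegment b ⁻¹' (initialSegment b '' staysBelow c a b) := by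
  refine (Set.subset_preimage_image _ _).antisymm ?_
  rintro ω ⟨ω', hω', he⟩ m ham hmb
  rw [← avg_congr fun i hi => congrFun he ⟨i, hi.trans_le hmb⟩]
  exact hω' m ham hmb

lemma findGreatest_eq_of_strictMono {T : ℕ → ℕ} (hT : StrictMono T) {k n : ℕ} (h₁ : T k ≤ n)
    (h₂ : n < T (k + 1)) : Nat.findGreatest (fun j => T j ≤ n) n = k := by
  refine Nat.findGreatest_eq_iff.2 ⟨hT.le_apply.trans h₁, fun _ => h₁, fun j hj _ hle => ?_⟩
  exact (h₂.trans_le (hT.monotone hj)).not_ge hle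

lemma wstarUpper_le_limsup_avg {w : ℝ} {ω : Traj Y O rmax} {T : ℕ → ℕ} (hT : StrictMono T)
    {i : ℕ} (h : ∀ᶠ k in atTop, (Nat.unpair k).1 = i →
      ω ∉ (staysBelow (w - (1 / 2) ^ k) (T k) (T (k + 1)) : Set (Traj Y O rmax))) :
    w ≤ limsup (avg ω) atTop := by
  refine le_of_forall_pos_sub_le fun δ hδ => ?_
  refine le_limsup_of_frequently_le (frequently_atTop.2 fun M => ?_) (isBoundedUnder_le_avg ω)
  have hδ' : ∀ᶠ k : ℕ in atTop, (1 / 2 : ℝ) ^ k ≤ δ :=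
    (tendsto_pow_atTop_nhds_zero_of_lt_one (by norm_num) (by norm_num)).eventually
      (eventually_le_nhds hδ)
  obtain ⟨K, hK⟩ := eventually_atTop.1 (h.and hδ')
  have hk := Nat.right_le_pair i (max K M)
  obtain ⟨hk₁, hk₂⟩ := hK (Nat.pair i (max K M)) ((le_max_left _ _).trans hk)
  have hk₃ := hk₁ (by simp)
  simp only [staysBelow, Set.mem_ofPred_eq, not_forall, not_lt] at hk₃
  obtain ⟨m, hm, -, hle⟩ := hk₃
  exact ⟨m, ((le_max_right _ _).trans hk).trans (hT.le_apply.trans hm.le), by linarith⟩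

end Trajectories

section Environments

variable {Y O : Type} [Fintype Y] [Fintype O] {rmax : ℕ}

lemma measurable_avg (m : ℕ) : Measurable fun ω : Traj Y O rmax => avg ω m :=
  (Finset.measurable_fun_sum _ fun i _ =>
    (measurable_of_countable rew).comp (measurable_pi_apply i)).div_const _

lemma measurable_limsup_avg : Measurable fun ω : Traj Y O rmax => limsup (avg ω) atTop :=
  Measurable.limsup measurable_avg

lemma measurableSet_staysBelow (c : ℝ) (a b : ℕ) :
    MeasurableSet (staysBelow c a b : Set (Traj Y O rmax)) := by
  have : (staysBelow c a b : Set (Traj Y O rmax))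
      = ⋂ m, ⋂ (_ : a < m), ⋂ (_ : m ≤ b), {ω | avg ω m < c} := by
    ext ω; simp [staysBelow]
  rw [this]
  exact .iInter fun m => .iInter fun _ => .iInter fun _ =>
    measurableSet_lt (measurable_avg m) measurable_const

lemma tendsto_staysBelow (μ : Measure (Traj Y O rmax)) [IsProbabilityMeasure μ] {c w : ℝ}
    (hcw : c < w) (hμ : μ {ω | w ≤ limsup (avg ω) atTop} = 1) (a : ℕ) :
    Tendsto (fun b => μ (staysBelow c a b)) atTop (nhds 0) := by
  have hanti : Antitone fun b => (staysBelow c a b : Set (Traj Y O rmax)) :=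
    fun b b' hb ω hω m h₁ h₂ => hω m h₁ (h₂.trans hb)
  have hlim := tendsto_measure_iInter_atTop (μ := μ)
    (fun b => (measurableSet_staysBelow c a b).nullMeasurableSet) hanti ⟨0, measure_ne_top _ _⟩
  have hnull : μ (⋂ b, staysBelow c a b) = 0 := by
    refine measure_mono_null ?_ ((prob_compl_eq_zero_iff
      (measurableSet_le measurable_const measurable_limsup_avg)).2 hμ)
    intro ω hω hw
    have hle : limsup (avg ω) atTop ≤ c := by
      refine limsup_le_of_le (isBoundedUnder_ge_avg ω).isCoboundedUnder_le ?_
      filter_upwards [eventually_gt_atTop a] with m hm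
      exact (Set.mem_iInter.1 hω m m hm le_rfl).le
    exact (hle.trans_lt hcw).not_ge hw
  exact hnull ▸ hlim

lemma histProbX_snoc (ν : Environment Y O rmax) (h : List (Cycle Y O rmax))
    (z : Cycle Y O rmax) : histProbX ν (h ++ [z]) = histProbX ν h * ν.cond h z.1 z.2 := by
  have key : ∀ l : List (Cycle Y O rmax), histProbX ν l = ∏ i ∈ Finset.range l.length,
      (l[i]?.elim 1 fun z => ν.cond (l.take i) z.1 z.2) := by
    intro l
    rw [Finset.prod_range]
    exact Finset.prod_congr rfl fun i _ => by simp
  rw [key, key, List.length_append, List.length_singleton, Finset.prod_range_succ]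
  congr 1
  · refine Finset.prod_congr rfl fun i hi => ?_
    have hi : i < h.length := Finset.mem_range.1 hi
    rw [List.getElem?_append_left hi, List.take_append_of_le_length hi.le]
  · simp

lemma histProbX_nonneg (ν : Environment Y O rmax) (h : List (Cycle Y O rmax)) :
    0 ≤ histProbX ν h :=
  Finset.prod_nonneg fun _ _ => ν.cond_nonneg _ _ _

lemma P_cylSet_nil (ν : Environment Y O rmax) (p : Policy Y O rmax) :
    ν.P p (cylSet []) = 1 := by
  have := ν.P_prob p
  have h : cylSet ([] : List (Cycle Y O rmax)) = Set.univ :=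
    Set.eq_univ_of_forall fun ω i => i.elim0
  rw [h, measure_univ]

lemma P_cylSet_le (ν : Environment Y O rmax) (p : Policy Y O rmax)
    (h : List (Cycle Y O rmax)) : ν.P p (cylSet h) ≤ ENNReal.ofReal (histProbX ν h) := by
  induction h using List.reverseRecOn with
  | nil => simp [P_cylSet_nil, histProbX]
  | append_singleton l z ih =>
    rw [ν.P_cyl, histProbX_snoc, ENNReal.ofReal_mul (histProbX_nonneg ν l)]
    gcongr
    split_ifs
    · exact le_rfl
    · exact ν.cond_nonneg _ _ _

lemma P_cylSet_of_follows (ν : Environment Y O rmax) (p : Policy Y O rmax)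
    (h : List (Cycle Y O rmax)) (hp : ∀ i, ∀ hi : i < h.length, p (h.take i) = h[i].1) :
    ν.P p (cylSet h) = ENNReal.ofReal (histProbX ν h) := by
  induction h using List.reverseRecOn with
  | nil => simp [P_cylSet_nil, histProbX]
  | append_singleton l z ih =>
    have hz : z.1 = p l := by
      have := hp l.length (by simp)
      simpa using this.symm
    rw [ν.P_cyl, histProbX_snoc, ENNReal.ofReal_mul (histProbX_nonneg ν l), if_pos hz, ih]
    intro i hi
    have := hp i (by simp; omega)
    rwa [List.take_append_of_le_length hi.le, List.getElem_append_left hi] at this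

lemma P_replacePolicy_cylSet (ν : Environment Y O rmax) (q : Policy Y O rmax)
    (h : List (Cycle Y O rmax)) :
    ν.P (replacePolicy h q) (cylSet h) = ENNReal.ofReal (histProbX ν h) := by
  refine P_cylSet_of_follows ν _ h fun i hi => ?_
  have hlen : (h.take i).length = i := by simp [hi.le]
  simp [replacePolicy, hlen, hi]

/-- Two policies that agree on the extensions of `h` of length less than `n` give proportional
probabilities to the extensions of `h` of length at most `n`. -/
lemma P_cylSet_append_mul (ν : Environment Y O rmax) {p p' : Policy Y O rmax}
    {h : List (Cycle Y O rmax)} {n : ℕ}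
    (hpp : ∀ s, (h ++ s).length < n → p (h ++ s) = p' (h ++ s)) (s : List (Cycle Y O rmax))
    (hs : (h ++ s).length ≤ n) :
    ν.P p (cylSet (h ++ s)) * ν.P p' (cylSet h) = ν.P p' (cylSet (h ++ s)) * ν.P p (cylSet h) := by
  induction s using List.reverseRecOn with
  | nil => simp [mul_comm]
  | append_singleton l z ih =>
    simp only [List.length_append, List.length_singleton] at hs ih hpp
    rw [← List.append_assoc, ν.P_cyl, ν.P_cyl, hpp l (by omega), mul_right_comm, ih (by omega),
      mul_right_comm]

lemma P_inter_cylSet_mul (ν : Environment Y O rmax) {p p' : Policy Y O rmax}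
    {h : List (Cycle Y O rmax)} {n : ℕ} (hn : h.length ≤ n)
    (hpp : ∀ s, (h ++ s).length < n → p (h ++ s) = p' (h ++ s))
    (S : Set (Fin n → Cycle Y O rmax)) :
    ν.P p (initialSegment n ⁻¹' S ∩ cylSet h) * ν.P p' (cylSet h)
      = ν.P p' (initialSegment n ⁻¹' S ∩ cylSet h) * ν.P p (cylSet h) := by
  have key : ν.P p' (cylSet h) • ((ν.P p).restrict (cylSet h)).map (initialSegment n)
      = ν.P p (cylSet h) • ((ν.P p').restrict (cylSet h)).map (initialSegment n) := by
    refine Measure.ext_of_singleton fun t => ?_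
    have hm := measurable_initialSegment (Y := Y) (O := O) (rmax := rmax) n
      (measurableSet_singleton t)
    simp only [Measure.smul_apply, smul_eq_mul,
      Measure.map_apply (measurable_initialSegment n) (measurableSet_singleton t),
      Measure.restrict_apply hm]
    rw [← cylSet_ofFn]
    by_cases hpre : h <+: List.ofFn t
    · obtain ⟨s, hs⟩ := hpre
      rw [← hs, Set.inter_eq_left.2 (cylSet_append_subset h s), mul_comm,
        P_cylSet_append_mul ν hpp s (by simp [hs]), mul_comm]
    · rw [cylSet_inter_eq_empty (by simpa using hn) hpre]
      simp
  have hS : MeasurableSet S := S.toFinite.measurableSet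
  have := congrArg (fun μ => μ S) key
  simp only [Measure.smul_apply, smul_eq_mul,
      Measure.map_apply (measurable_initialSegment n) hS,
      Measure.restrict_apply (measurable_initialSegment n hS)] at this
  rw [mul_comm, this, mul_comm]

lemma exists_policy_wstarUpper_le (ν : Environment Y O rmax) (hν : StronglyUpperExplorable ν)
    (h : List (Cycle Y O rmax)) (hpos : 0 < histProbX ν h) :
    ∃ q, condProb ν q h {ω | WstarUpper ν ≤ limsup (avg ω) atTop} = 1 := by
  have hbdd : BddBelow {V | ∃ h, 0 < histProbX ν h ∧ IsCondUpperOptimalValue ν h V} := by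
    refine ⟨0, ?_⟩
    rintro V ⟨h, -, q, hq, -⟩
    have hne : (condMeasure ν q h) {ω | limsup (avg ω) atTop = V} ≠ 0 := by
      change condProb ν q h _ ≠ 0
      rw [show condProb ν q h {ω | limsup (avg ω) atTop = V} = 1 from hq]
      exact one_ne_zero
    obtain ⟨ω, hω⟩ := nonempty_of_measure_ne_zero hne
    exact (limsup_avg_nonneg ω).trans_eq hω
  obtain ⟨V, hV⟩ := hν h hpos
  have hW : WstarUpper ν ≤ V := csInf_le hbdd ⟨h, hpos, hV⟩
  obtain ⟨q, hq, -⟩ := hV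
  refine ⟨q, le_antisymm ?_ ?_⟩
  · have := ν.P_prob (replacePolicy h q)
    have : IsZeroOrProbabilityMeasure (condMeasure ν q h) := by
      unfold condMeasure; infer_instance
    exact prob_le_one
  · rw [← show condProb ν q h {ω | limsup (avg ω) atTop = V} = 1 from hq]
    exact measure_mono fun ω (hω : _ = V) => hW.trans_eq hω.symm

lemma exists_horizon (ν : Environment Y O rmax)
    (opt : List (Cycle Y O rmax) → Policy Y O rmax)
    (hopt : ∀ h, 0 < histProbX ν h →
      condProb ν (opt h) h {ω | WstarUpper ν ≤ limsup (avg ω) atTop} = 1)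
    (a : ℕ) {ε : ℝ} (hε : 0 < ε) :
    ∃ b, a < b ∧ ∀ h : List (Cycle Y O rmax), h.length = a → 0 < histProbX ν h →
      condProb ν (opt h) h (staysBelow (WstarUpper ν - ε) a b) ≤ ENNReal.ofReal ε := by
  have hev : ∀ t : Fin a → Cycle Y O rmax, ∀ᶠ b in atTop, 0 < histProbX ν (List.ofFn t) →
      condProb ν (opt (List.ofFn t)) (List.ofFn t) (staysBelow (WstarUpper ν - ε) a b)
        ≤ ENNReal.ofReal ε := by
    intro t
    by_cases hpos : 0 < histProbX ν (List.ofFn t)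
    · have hprob : IsProbabilityMeasure (condMeasure ν (opt (List.ofFn t)) (List.ofFn t)) := by
        have := ν.P_prob (replacePolicy (List.ofFn t) (opt (List.ofFn t)))
        refine ProbabilityTheory.cond_isProbabilityMeasure ?_
        rw [P_replacePolicy_cylSet]
        exact (ENNReal.ofReal_pos.2 hpos).ne'
      have := tendsto_staysBelow _ (sub_lt_self _ hε) (hopt _ hpos) a
      filter_upwards [this.eventually (eventually_le_nhds (ENNReal.ofReal_pos.2 hε))] with b hb _
      exact hb
    · exact Eventually.of_forall fun b hb => (hpos hb).elim
  obtain ⟨b, hab, hb⟩ := ((eventually_gt_atTop a).and (eventually_all.2 hev)).exists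
  refine ⟨b, hab, fun h hh hpos => ?_⟩
  subst hh
  have := hb h.get
  rw [List.ofFn_get] at this
  exact this hpos

lemma P_staysBelow_le (ν : Environment Y O rmax)
    (opt : List (Cycle Y O rmax) → Policy Y O rmax) (p : Policy Y O rmax) {a b : ℕ} {c : ℝ}
    {ε : ℝ≥0∞} (hab : a ≤ b)
    (hb : ∀ h : List (Cycle Y O rmax), h.length = a → 0 < histProbX ν h →
      condProb ν (opt h) h (staysBelow c a b) ≤ ε)
    (hp : ∀ l : List (Cycle Y O rmax), a ≤ l.length → l.length < b → p l = opt (l.take a) l) :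
    ν.P p (staysBelow c a b) ≤ ε := by
  have := ν.P_prob p
  have hcyl : ∀ h : List (Cycle Y O rmax), h.length = a →
      ν.P p (staysBelow c a b ∩ cylSet h) ≤ ε * ν.P p (cylSet h) := by
    intro h hh
    by_cases h0 : ν.P p (cylSet h) = 0
    · exact (measure_mono_null Set.inter_subset_right h0).trans_le zero_le
    have hpos : 0 < histProbX ν h :=
      ENNReal.ofReal_pos.1 ((pos_iff_ne_zero.2 h0).trans_le (P_cylSet_le ν p h))
    have hprob := ν.P_prob (replacePolicy h (opt h))
    have hne : ν.P (replacePolicy h (opt h)) (cylSet h) ≠ 0 := by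
      rw [P_replacePolicy_cylSet]
      exact (ENNReal.ofReal_pos.2 hpos).ne'
    have hmul := P_inter_cylSet_mul ν (p := p) (p' := replacePolicy h (opt h)) (h := h)
      (n := b) (hh.trans_le hab) (fun s hs => by
        have hlen : a ≤ (h ++ s).length := by simp [hh]
        rw [hp _ hlen hs, replacePolicy, dif_neg (by simp), ← hh, List.take_left])
      (initialSegment b '' staysBelow c a b)
    rw [← staysBelow_eq_preimage] at hmul
    rw [← ENNReal.mul_le_mul_iff_left hne (measure_ne_top _ _), hmul, mul_right_comm]
    gcongr
    rw [Set.inter_comm, ← ProbabilityTheory.cond_mul_eq_inter (measurableSet_cylSet h)]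
    gcongr
    exact hb h hh hpos
  calc ν.P p (staysBelow c a b)
      ≤ ν.P p (⋃ t : Fin a → Cycle Y O rmax, staysBelow c a b ∩ cylSet (List.ofFn t)) := by
        refine measure_mono fun ω hω => Set.mem_iUnion.2 ⟨initialSegment a ω, hω, ?_⟩
        rw [cylSet_ofFn]; rfl
    _ ≤ ∑ t : Fin a → Cycle Y O rmax, ν.P p (staysBelow c a b ∩ cylSet (List.ofFn t)) :=
        measure_iUnion_fintype_le _ _
    _ ≤ ∑ t : Fin a → Cycle Y O rmax, ε * ν.P p (cylSet (List.ofFn t)) :=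
        Finset.sum_le_sum fun t _ => hcyl _ (by simp)
    _ = ε := by
        simp_rw [cylSet_ofFn]
        rw [← Finset.mul_sum, sum_measure_preimage_singleton _ fun t _ =>
          measurable_initialSegment a (measurableSet_singleton t)]
        simp

end Environments

/-- **Theorem 3(ii) (worst-case upper self-optimizing).**
For any countable set `C` of strongly upper explorable environments there exists a policy
`p` with `limsup_m (1/m) r_{1..m}^{pν} ≥ W̄*_ν` with probability 1 for every `ν ∈ C`. -/
theorem worstCase_upperSelfOptimizing {Y O : Type} [Fintype Y] [Fintype O]
    [Nonempty Y] [Nonempty O] {rmax : ℕ}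
    (C : Set (Environment Y O rmax)) (hcount : C.Countable)
    (hsue : ∀ ν ∈ C, StronglyUpperExplorable ν) :
    ∃ p : Policy Y O rmax, ∀ ν ∈ C,
      ν.P p {ω | WstarUpper ν ≤ limsup (avg ω) atTop} = 1 := by
  rcases C.eq_empty_or_nonempty with rfl | hne
  · exact ⟨fun _ => Classical.arbitrary Y, fun ν hν => hν.elim⟩
  obtain ⟨f, rfl⟩ := hcount.exists_eq_range hne
  have hq : ∀ i h, ∃ q, 0 < histProbX (f i) h →
      condProb (f i) q h {ω | WstarUpper (f i) ≤ limsup (avg ω) atTop} = 1 := by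
    intro i h
    by_cases hpos : 0 < histProbX (f i) h
    · obtain ⟨q, hq⟩ := exists_policy_wstarUpper_le (f i) (hsue _ ⟨i, rfl⟩) h hpos
      exact ⟨q, fun _ => hq⟩
    · exact ⟨fun _ => Classical.arbitrary Y, fun h => (hpos h).elim⟩
  choose opt hopt using hq
  choose nextTime hnext_gt hnext using fun (k a : ℕ) =>
    exists_horizon (f (Nat.unpair k).1) (opt (Nat.unpair k).1) (hopt _) a
      (ε := (1 / 2) ^ k) (by positivity)
  let T : ℕ → ℕ := fun n => Nat.rec (motive := fun _ => ℕ) 0 nextTime n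
  have hT : StrictMono T := strictMono_nat_of_lt_succ fun k => hnext_gt k (T k)
  let phase : ℕ → ℕ := fun n => Nat.findGreatest (fun j : ℕ => T j ≤ n) n
  let p : Policy Y O rmax := fun l =>
    opt (Nat.unpair (phase l.length)).1 (l.take (T (phase l.length))) l
  have hbad : ∀ k, (f (Nat.unpair k).1).P p (staysBelow
      (WstarUpper (f (Nat.unpair k).1) - (1 / 2) ^ k) (T k) (T (k + 1)))
        ≤ ENNReal.ofReal ((1 / 2) ^ k) := by
    intro k
    refine P_staysBelow_le _ (opt (Nat.unpair k).1) p (hT.monotone k.le_succ) (hnext k (T k)) ?_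
    intro l h₁ h₂
    have hphase : phase l.length = k := findGreatest_eq_of_strictMono hT h₁ h₂
    simp only [p, hphase]
  refine ⟨p, ?_⟩
  rintro _ ⟨i, rfl⟩
  have := (f i).P_prob p
  have hsum : ∑' k, (f i).P p {ω | (Nat.unpair k).1 = i ∧ ω ∈ staysBelow
      (WstarUpper (f i) - (1 / 2) ^ k) (T k) (T (k + 1))} ≠ ∞ := by
    refine ne_top_of_le_ne_top (summable_geometric_two).tsum_ofReal_ne_top
      (ENNReal.tsum_le_tsum fun k => ?_)
    by_cases hk : (Nat.unpair k).1 = i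
    · subst hk
      simpa using hbad k
    · simp [hk]
  have hae : ∀ᵐ ω ∂(f i).P p, WstarUpper (f i) ≤ limsup (avg ω) atTop := by
    filter_upwards [ae_eventually_notMem hsum] with ω hω
    exact wstarUpper_le_limsup_avg hT (hω.mono fun k hk hki hmem => hk ⟨hki, hmem⟩)
  rw [measure_congr (eventuallyEq_univ.2 hae), measure_univ]

end RL
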